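/- Theorem (Brenti's recursive matrix). Let t ∈ ℕ and let x, y, z : ℕ → MvPolynomial σ ℝ be sequences of nonnegative polynomials. Define A : ℕ → ℕ → MvPolynomial σ ℝ by A 0 0 = 1 and, for n + k ≥ 1, A n k = (z n) · A (n−t) (k−1) + (y n) · A (n−t−1) (k−1) + (x n) · A (n−1) k, where any term with a negative index is 0. Then the matrix A is totally positive, and if t ≥ 1 then for every n ∈ ℕ the Toeplitz matrix 𝒯(c) of the n-th row sequence c k = A n k is totally positive. -/

import Mathlib

open Finset

/-- A multivariate polynomial with real coefficients is *nonnegative* if all of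
its coefficients are nonnegative. -/
def PolyNonneg {σ : Type*} (p : MvPolynomial σ ℝ) : Prop :=
  ∀ m, 0 ≤ p.coeff m

/-- An `ℕ × ℕ` matrix with entries in `MvPolynomial σ ℝ` is *totally positive*
if every minor (taken along strictly increasing row and column indices) is a
nonnegative polynomial. -/
def TP {σ : Type*} (A : ℕ → ℕ → MvPolynomial σ ℝ) : Prop :=
  ∀ r : ℕ, 1 ≤ r → ∀ ρ κ : Fin r → ℕ, StrictMono ρ → StrictMono κ →
    PolyNonneg (Matrix.of fun i j : Fin r => A (ρ i) (κ j)).det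

/-- The Toeplitz matrix of a sequence: `𝒯(c) i j = c (i - j)` for `i ≥ j`
and `0` otherwise. -/
def toeplitz {R : Type*} [CommRing R] (c : ℕ → R) : ℕ → ℕ → R :=
  fun i j => if j ≤ i then c (i - j) else 0

/-- Brenti's recursive matrix: `A 0 0 = 1` and for `n + k ≥ 1`,
`A n k = z n · A (n-t) (k-1) + y n · A (n-t-1) (k-1) + x n · A (n-1) k`,
where any term with a negative index vanishes. -/
noncomputable def brenti {σ : Type*} (t : ℕ) (x y z : ℕ → MvPolynomial σ ℝ) :
    ℕ → ℕ → MvPolynomial σ ℝ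
  | 0, 0 => 1
  | 0, k + 1 => if t = 0 then z 0 * brenti t x y z 0 k else 0
  | n + 1, 0 => x (n + 1) * brenti t x y z n 0
  | n + 1, k + 1 =>
      (if t ≤ n + 1 then z (n + 1) * brenti t x y z (n + 1 - t) k else 0) +
        (if t + 1 ≤ n + 1 then y (n + 1) * brenti t x y z (n - t) k else 0) +
        x (n + 1) * brenti t x y z n (k + 1)
  termination_by n k => (k, n)

section Nonneg

variable {σ : Type*}

lemma PolyNonneg.zero : PolyNonneg (0 : MvPolynomial σ ℝ) := fun m => by simp

lemma PolyNonneg.one : PolyNonneg (1 : MvPolynomial σ ℝ) := fun m => by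
  classical
  rw [MvPolynomial.coeff_one]
  split_ifs <;> norm_num

lemma PolyNonneg.add {p q : MvPolynomial σ ℝ} (hp : PolyNonneg p) (hq : PolyNonneg q) :
    PolyNonneg (p + q) := fun m => by
  rw [MvPolynomial.coeff_add]
  exact add_nonneg (hp m) (hq m)

lemma PolyNonneg.mul {p q : MvPolynomial σ ℝ} (hp : PolyNonneg p) (hq : PolyNonneg q) :
    PolyNonneg (p * q) := fun m => by
  classical
  rw [MvPolynomial.coeff_mul]
  exact Finset.sum_nonneg fun a _ => mul_nonneg (hp _) (hq _)

lemma PolyNonneg.sum {ι : Type*} (s : Finset ι) {f : ι → MvPolynomial σ ℝ}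
    (hf : ∀ i, PolyNonneg (f i)) : PolyNonneg (∑ i ∈ s, f i) :=
  Finset.sum_induction f PolyNonneg (fun _ _ => .add) .zero fun i _ => hf i

lemma PolyNonneg.prod {ι : Type*} (s : Finset ι) {f : ι → MvPolynomial σ ℝ}
    (hf : ∀ i, PolyNonneg (f i)) : PolyNonneg (∏ i ∈ s, f i) :=
  Finset.prod_induction f PolyNonneg (fun _ _ => .mul) .one fun i _ => hf i

end Nonneg

namespace TP

variable {σ : Type*}

/-- Minors of a totally positive matrix along weakly increasing rows are nonnegative, since a
repeated row makes the minor vanish. -/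
lemma det_monotone {B : ℕ → ℕ → MvPolynomial σ ℝ} (hB : TP B) {r : ℕ} {ρ κ : Fin r → ℕ}
    (hρ : Monotone ρ) (hκ : StrictMono κ) :
    PolyNonneg (Matrix.of fun i j : Fin r => B (ρ i) (κ j)).det := by
  rcases Nat.eq_zero_or_pos r with rfl | hr
  · rw [Matrix.det_isEmpty]
    exact .one
  by_cases hinj : Function.Injective ρ
  · exact hB r hr ρ κ (hρ.strictMono_of_injective hinj) hκ
  · simp only [Function.Injective, not_forall] at hinj
    obtain ⟨a, b, hab, hne⟩ := hinj
    rw [Matrix.det_zero_of_row_eq hne (by ext j; simp [hab])]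
    exact .zero

/-- The zero matrix is totally positive. -/
lemma zero : TP (σ := σ) fun _ _ => 0 := fun r hr _ _ _ _ => by
  have : Nonempty (Fin r) := ⟨⟨0, hr⟩⟩
  have hdet : (Matrix.of fun _ _ : Fin r => (0 : MvPolynomial σ ℝ)).det = 0 := Matrix.det_zero
  rw [hdet]
  exact .zero

/-- If every finite set of indices lies in a region where `C` agrees with a totally positive
matrix, then `C` is totally positive. -/
lemma of_eventually_eq {C : ℕ → ℕ → MvPolynomial σ ℝ}
    (h : ∀ m, ∃ B, TP B ∧ ∀ n ≤ m, ∀ k ≤ m, C n k = B n k) : TP C := by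
  intro r hr ρ κ hρ hκ
  obtain ⟨B, hB, hBC⟩ := h (∑ i, ρ i + ∑ i, κ i)
  convert hB r hr ρ κ hρ hκ using 3
  ext i j : 2
  refine hBC _ ?_ _ ?_
  · exact (Finset.single_le_sum (f := ρ) (fun _ _ => Nat.zero_le _) (mem_univ i)).trans
      (Nat.le_add_right _ _)
  · exact (Finset.single_le_sum (f := κ) (fun _ _ => Nat.zero_le _) (mem_univ j)).trans
      (Nat.le_add_left _ _)

/-- Left multiplication by a nonnegative lower bidiagonal matrix preserves total positivity. -/
lemma bidiagonal_mul {B : ℕ → ℕ → MvPolynomial σ ℝ} (hB : TP B) {a b : ℕ → MvPolynomial σ ℝ}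
    (ha : ∀ n, PolyNonneg (a n)) (hb : ∀ n, PolyNonneg (b n)) :
    TP fun n k => a n * B (n - 1) k + b n * B n k := by
  classical
  intro r _ ρ κ hρ hκ
  have key : (Matrix.of fun i j : Fin r =>
        a (ρ i) * B (ρ i - 1) (κ j) + b (ρ i) * B (ρ i) (κ j)).det =
      ∑ s : Finset (Fin r), (∏ i, if i ∈ s then a (ρ i) else b (ρ i)) *
        (Matrix.of fun i j : Fin r => B (if i ∈ s then ρ i - 1 else ρ i) (κ j)).det := by
    have hadd := (Matrix.detRowAlternating (R := MvPolynomial σ ℝ)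
      (n := Fin r)).toMultilinearMap.map_add_univ
        (fun i j => a (ρ i) * B (ρ i - 1) (κ j)) (fun i j => b (ρ i) * B (ρ i) (κ j))
    refine hadd.trans (Finset.sum_congr rfl fun s _ => ?_)
    have hsmul := (Matrix.detRowAlternating (R := MvPolynomial σ ℝ)
      (n := Fin r)).toMultilinearMap.map_smul_univ
        (fun i => if i ∈ s then a (ρ i) else b (ρ i))
        (fun i j => B (if i ∈ s then ρ i - 1 else ρ i) (κ j))
    refine Eq.trans (congrArg _ ?_) hsmul
    ext i j : 2
    by_cases hi : i ∈ s <;> simp [hi]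
  rw [key]
  refine .sum _ fun s => .mul (.prod _ fun i => ?_) (det_monotone hB ?_ hκ)
  · split_ifs
    exacts [ha _, hb _]
  · intro i j hij
    rcases hij.eq_or_lt with rfl | hlt
    · rfl
    · have := hρ hlt
      dsimp only
      split_ifs <;> omega

/-- Inserting `t` zero rows on top preserves total positivity. -/
lemma shift {B : ℕ → ℕ → MvPolynomial σ ℝ} (hB : TP B) (t : ℕ) :
    TP fun n k => if t ≤ n then B (n - t) k else 0 := by
  induction t with
  | zero => simpa using hB
  | succ t ih =>
    convert ih.bidiagonal_mul (a := fun n => if n = 0 then 0 else 1) (b := fun _ => 0)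
      (fun n => by split_ifs; exacts [.zero, .one]) (fun _ => .zero) using 3 with n k
    rcases n with _ | n
    · simp
    · simp [Nat.add_sub_add_right]

/-- Prepending the column `(1, 0, 0, …)` preserves total positivity. -/
lemma cons_unit_column {B E : ℕ → ℕ → MvPolynomial σ ℝ} (hB : TP B) (h00 : E 0 0 = 1)
    (h0 : ∀ n, E (n + 1) 0 = 0) (hE : ∀ n k, E n (k + 1) = B n k) : TP E := by
  intro r hr ρ κ hρ hκ
  obtain ⟨r, rfl⟩ := Nat.exists_eq_succ_of_ne_zero (Nat.one_le_iff_ne_zero.mp hr)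
  have hpred : ∀ j, κ j ≠ 0 → ∀ n, E n (κ j) = B n (κ j - 1) := fun j hj n => by
    obtain ⟨k, hk⟩ := Nat.exists_eq_succ_of_ne_zero hj
    rw [hk, hE, Nat.succ_sub_one]
  have hzero : ∀ i, ρ i ≠ 0 → E (ρ i) 0 = 0 := fun i hi => by
    obtain ⟨n, hn⟩ := Nat.exists_eq_succ_of_ne_zero hi
    rw [hn, h0]
  by_cases hκ0 : κ 0 = 0
  · have hκs : ∀ j : Fin r, 0 < κ j.succ := fun j =>
      (Nat.zero_le _).trans_lt (hκ (Fin.succ_pos j))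
    have hρs : ∀ i : Fin r, ρ i.succ ≠ 0 := fun i =>
      ((Nat.zero_le _).trans_lt (hρ (Fin.succ_pos i))).ne'
    rw [Matrix.det_succ_column_zero, Fin.sum_univ_succ,
      Finset.sum_eq_zero (fun i _ => by simp [hκ0, hzero _ (hρs i)]), add_zero]
    by_cases hρ0 : ρ 0 = 0
    · have hminor := hB.det_monotone (ρ := fun i : Fin r => ρ i.succ)
        (κ := fun j : Fin r => κ j.succ - 1)
        (fun i j hij => hρ.monotone (Fin.succ_le_succ_iff.mpr hij)) (fun i j hij => by
          have := hκ (Fin.succ_lt_succ_iff.mpr hij)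
          have := hκs i
          dsimp only
          omega)
      convert hminor using 1
      simp only [Fin.val_zero, pow_zero, Matrix.of_apply, hρ0, hκ0, h00, one_mul]
      congr 1
      ext i j : 2
      simp [hpred _ (hκs j).ne']
    · simp only [Matrix.of_apply, hκ0, hzero _ hρ0, mul_zero, zero_mul]
      exact .zero
  · have hκs : ∀ j, 0 < κ j := fun j =>
      (Nat.pos_of_ne_zero hκ0).trans_le (hκ.monotone (Fin.zero_le j))
    simp only [fun j n => hpred j (hκs j).ne' n]
    exact hB _ hr ρ (fun j => κ j - 1) hρ fun i j hij => by
      have := hκ hij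
      have := hκs i
      dsimp only
      omega

/-- Left multiplication by the inverse of the unit lower bidiagonal matrix with subdiagonal
entries `-x n` preserves total positivity. -/
lemma of_recurrence {B C : ℕ → ℕ → MvPolynomial σ ℝ} {x : ℕ → MvPolynomial σ ℝ} (hB : TP B)
    (hx : ∀ n, PolyNonneg (x n)) (h0 : ∀ k, C 0 k = B 0 k)
    (hC : ∀ n k, C (n + 1) k = B (n + 1) k + x (n + 1) * C n k) : TP C := by
  have hybrid : ∀ m, TP fun n k => if n ≤ m then C n k else B n k := by
    intro m
    induction m with
    | zero =>
      convert hB using 3 with n k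
      split_ifs with hn
      · rw [Nat.le_zero.mp hn, h0]
      · rfl
    | succ m ih =>
      convert ih.bidiagonal_mul (a := fun n => if n = m + 1 then x (m + 1) else 0)
        (b := fun _ => 1) (fun n => by split_ifs; exacts [hx _, .zero])
        (fun _ => .one) using 3 with n k
      rcases lt_trichotomy n (m + 1) with hn | rfl | hn
      · simp [hn.ne, hn.le, Nat.lt_succ_iff.mp hn]
      · simp [hC, add_comm]
      · simp [hn.ne', not_le.mpr hn, not_le.mpr ((Nat.lt_succ_self m).trans hn)]
  exact of_eventually_eq fun m => ⟨_, hybrid m, fun n hn k _ => by simp [hn]⟩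

/-- The identity matrix is totally positive. -/
lemma identity : TP (σ := σ) fun n k => if n = k then 1 else 0 := by
  have hK : ∀ K, TP (σ := σ) fun n k => if n = k ∧ k < K then 1 else 0 := by
    intro K
    induction K with
    | zero => simpa using TP.zero
    | succ K ih =>
      refine (ih.shift 1).cons_unit_column (by simp) (by simp) fun n k => ?_
      rcases n with _ | n <;> simp
  exact of_eventually_eq fun m => ⟨_, hK (m + 1), fun n _ k hk => by
    simp [Nat.lt_succ_iff.mpr hk]⟩

/-- Restricting to strictly increasing rows and columns preserves total positivity. -/
lemma submatrix {B : ℕ → ℕ → MvPolynomial σ ℝ} (hB : TP B) {f g : ℕ → ℕ} (hf : StrictMono f)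
    (hg : StrictMono g) : TP fun n k => B (f n) (g k) :=
  fun r hr ρ κ hρ hκ => hB r hr (f ∘ ρ) (g ∘ κ) (hf.comp hρ) (hg.comp hκ)

end TP

section Brenti

variable {σ : Type*} {t : ℕ} {x y z : ℕ → MvPolynomial σ ℝ}

lemma tp_brenti (hx : ∀ n, PolyNonneg (x n)) (hy : ∀ n, PolyNonneg (y n))
    (hz : ∀ n, PolyNonneg (z n)) : TP (brenti t x y z) := by
  have hK : ∀ K, TP fun n k => if k < K then brenti t x y z n k else 0 := by
    intro K
    induction K with
    | zero => simpa using TP.zero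
    | succ K ih =>
      have hQ := (ih.shift t).bidiagonal_mul (a := fun n => if n = 0 then 0 else y n)
        (fun n => by split_ifs; exacts [.zero, hy n]) hz
      set Q : ℕ → ℕ → MvPolynomial σ ℝ := fun n k => _ + _ with hQ_def
      obtain ⟨E, h00, h0, hE⟩ : ∃ E : ℕ → ℕ → MvPolynomial σ ℝ, E 0 0 = 1 ∧
          (∀ n, E (n + 1) 0 = 0) ∧ ∀ n k, E n (k + 1) = Q n k :=
        ⟨fun n k => Nat.casesOn k (if n = 0 then 1 else 0) (Q n), by simp, by simp,
          fun _ _ => rfl⟩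
      refine (hQ.cons_unit_column h00 h0 hE).of_recurrence hx (fun k => ?_) fun n k => ?_
      · rcases k with _ | k
        · simp [brenti, h00]
        · by_cases ht : t = 0 <;> simp [brenti, ht, hE, hQ_def]
      · rcases k with _ | k
        · simp [brenti, h0]
        · by_cases hk : k < K
          · simp [brenti, hk, hE, hQ_def, add_comm]
          · simp [hk, hE, hQ_def]
  exact TP.of_eventually_eq fun m => ⟨_, hK (m + 1), fun n _ k hk => by
    simp [Nat.lt_succ_iff.mpr hk]⟩

variable (t x y z) in
/-- The Toeplitz matrices of the rows `n, n - 1, …, n - t` of Brenti's matrix, interleaved: the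
row with index `i * (t + 1) + s`, `s ≤ t`, is the `i`-th row of the Toeplitz matrix of the
`(n - s)`-th row of Brenti's matrix (zero if `n < s`). -/
noncomputable def interleavedToeplitz (n p j : ℕ) : MvPolynomial σ ℝ :=
  if p % (t + 1) ≤ n then toeplitz (brenti t x y z (n - p % (t + 1))) (p / (t + 1)) j else 0

lemma interleavedToeplitz_mul_add (n i j : ℕ) {s : ℕ} (hs : s ≤ t) :
    interleavedToeplitz t x y z n (i * (t + 1) + s) j =
      if s ≤ n then toeplitz (brenti t x y z (n - s)) i j else 0 := by
  have hmod : (i * (t + 1) + s) % (t + 1) = s := by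
    rw [Nat.mul_add_mod', Nat.mod_eq_of_lt (by omega)]
  have hdiv : (i * (t + 1) + s) / (t + 1) = i := by
    rw [Nat.mul_comm, Nat.mul_add_div (by omega), Nat.div_eq_of_lt (by omega), add_zero]
  rw [interleavedToeplitz, hmod, hdiv]

lemma toeplitz_brenti_succ_zero (n j : ℕ) :
    toeplitz (brenti t x y z (n + 1)) 0 j = x (n + 1) * toeplitz (brenti t x y z n) 0 j := by
  rcases j with _ | j <;> simp [toeplitz, brenti]

lemma toeplitz_brenti_succ_succ (n i j : ℕ) :
    toeplitz (brenti t x y z (n + 1)) (i + 1) j =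
      (if t ≤ n + 1 then z (n + 1) * toeplitz (brenti t x y z (n + 1 - t)) i j else 0) +
        (if t ≤ n then y (n + 1) * toeplitz (brenti t x y z (n - t)) i j else 0) +
        x (n + 1) * toeplitz (brenti t x y z n) (i + 1) j := by
  rcases lt_trichotomy j (i + 1) with hj | rfl | hj
  · have hj' : j ≤ i := by omega
    simp [toeplitz, hj', hj.le, Nat.succ_sub hj', brenti]
  · simp [toeplitz, brenti]
  · have hj' : ¬ j ≤ i := by omega
    simp [toeplitz, hj', not_le.mpr hj]

lemma tp_interleavedToeplitz (ht : 1 ≤ t) (hx : ∀ n, PolyNonneg (x n))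
    (hy : ∀ n, PolyNonneg (y n)) (hz : ∀ n, PolyNonneg (z n)) (n : ℕ) :
    TP (interleavedToeplitz t x y z n) := by
  induction n with
  | zero =>
    convert TP.identity.submatrix (σ := σ) strictMono_id
      (g := fun j => j * (t + 1)) (fun i j hij => Nat.mul_lt_mul_of_pos_right hij t.succ_pos)
      using 3 with p j
    obtain ⟨i, s, hs, rfl⟩ : ∃ i s, s ≤ t ∧ p = i * (t + 1) + s :=
      ⟨p / (t + 1), p % (t + 1), Nat.lt_succ_iff.mp (Nat.mod_lt _ t.succ_pos),
        (Nat.div_add_mod' p (t + 1)).symm⟩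
    rw [interleavedToeplitz_mul_add 0 i j hs, id_eq]
    rcases s with _ | s
    · rcases lt_trichotomy i j with hij | rfl | hij
      · simp [toeplitz, hij.ne, not_le.mpr hij]
      · simp [toeplitz, brenti]
      · obtain ⟨k, rfl⟩ := Nat.exists_eq_add_of_lt hij
        simp [toeplitz, add_assoc, brenti, Nat.one_le_iff_ne_zero.mp ht]
    · have hne : i * (t + 1) + (s + 1) ≠ j * (t + 1) := fun h => by
        have := congrArg (· % (t + 1)) h
        simp [Nat.mod_eq_of_lt (Nat.lt_succ_iff.mpr hs)] at this
      simp [hne]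
  | succ n ih =>
    have h₁ := ih.bidiagonal_mul
      (a := fun p => if p = 0 then 0 else if p % (t + 1) = 0 then y (n + 1) else 1)
      (b := fun p => if p % (t + 1) = 0 then x (n + 1) else 0)
      (fun p => by split_ifs; exacts [.zero, hy _, .one])
      (fun p => by split_ifs; exacts [hx _, .zero])
    have h₂ := h₁.bidiagonal_mul
      (a := fun p => if p = 0 then 0 else if p % (t + 1) = 0 then z (n + 1) else 0)
      (b := fun _ => 1)
      (fun p => by split_ifs; exacts [.zero, hz _, .zero]) (fun _ => .one)
    convert h₂ using 3 with p j
    obtain ⟨i, s, hs, rfl⟩ : ∃ i s, s ≤ t ∧ p = i * (t + 1) + s :=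
      ⟨p / (t + 1), p % (t + 1), Nat.lt_succ_iff.mp (Nat.mod_lt _ t.succ_pos),
        (Nat.div_add_mod' p (t + 1)).symm⟩
    rcases s with _ | s
    · rcases i with _ | i
      · simp [interleavedToeplitz, toeplitz_brenti_succ_zero]
      · obtain ⟨u, rfl⟩ := Nat.exists_eq_add_of_le' ht
        have hp : (i + 1) * (u + 1 + 1) + 0 - 1 = i * (u + 1 + 1) + (u + 1) := by
          rw [add_mul]; omega
        have hp' : i * (u + 1 + 1) + (u + 1) - 1 = i * (u + 1 + 1) + u := by omega
        have hmod : (i * (u + 1 + 1) + (u + 1)) % (u + 1 + 1) ≠ 0 := by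
          simp
        rw [hp, hp', interleavedToeplitz_mul_add _ _ _ (Nat.zero_le _),
          interleavedToeplitz_mul_add _ _ _ (Nat.zero_le _),
          interleavedToeplitz_mul_add _ _ _ le_rfl,
          interleavedToeplitz_mul_add _ _ _ (Nat.le_succ u), Nat.sub_zero, Nat.sub_zero,
          toeplitz_brenti_succ_succ, if_neg hmod, if_neg hmod]
        simp [add_assoc]
    · have hmod : (i * (t + 1) + (s + 1)) % (t + 1) ≠ 0 := by
        simp [Nat.mod_eq_of_lt (Nat.lt_succ_iff.mpr hs)]
      rw [Nat.add_sub_assoc (Nat.le_add_left 1 s), Nat.add_sub_cancel,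
        interleavedToeplitz_mul_add _ _ _ hs, interleavedToeplitz_mul_add n i j (by omega)]
      simp only [hmod]
      simp

end Brenti

/-- **Theorem (Brenti's recursive matrix).**  For sequences of nonnegative
polynomials `x, y, z`, Brenti's recursive matrix `A` is totally positive, and
if `t ≥ 1` then every row of `A` has a totally positive Toeplitz matrix. -/
theorem brenti_totallyPositive {σ : Type*} (t : ℕ)
    (x y z : ℕ → MvPolynomial σ ℝ)
    (hx : ∀ n, PolyNonneg (x n)) (hy : ∀ n, PolyNonneg (y n))
    (hz : ∀ n, PolyNonneg (z n)) :
    TP (brenti t x y z) ∧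
      (1 ≤ t → ∀ n, TP (toeplitz fun k => brenti t x y z n k)) := by
  refine ⟨tp_brenti hx hy hz, fun ht n => ?_⟩
  convert (tp_interleavedToeplitz ht hx hy hz n).submatrix
    (f := fun i => i * (t + 1)) (fun i j hij => Nat.mul_lt_mul_of_pos_right hij t.succ_pos)
    strictMono_id using 3 with i j
  simpa using (interleavedToeplitz_mul_add n i j (Nat.zero_le t)).symm
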